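/- arXiv:1909.06197 — 5 statements merged into one kernel-verified Lean document; each statement's English description precedes it below -/
import Mathlib

section
/- Let d ≥ 1 be an integer. The rate function I is strictly decreasing in each of its three parameters on the admissible domain {(θ,k,a) : θ ∈ [0,1), k ∈ [0,(1−θ²)/d), a ∈ [0, 1−θ²−k·d)}. Precisely: (i) if (θ₁,k,a) and (θ₂,k,a) are both admissible and θ₁ < θ₂, then I(θ₂,k,a) < I(θ₁,k,a); (ii) if (θ,k₁,a) and (θ,k₂,a) are both admissible and k₁ < k₂, then I(θ,k₂,a) < I(θ,k₁,a); (iii) if (θ,k,a₁) and (θ,k,a₂) are both admissible and a₁ < a₂, then I(θ,k,a₂) < I(θ,k,a₁). -/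
/-- The large-deviation rate function `I(θ,k,a) = inf_{ρ ∈ (0,ρ̄]} f_{θ,k,a}(ρ)`, where
`γ = a + k·d`, `ρ̄ = 1 − γ/2 − √((γ/2)² + θ²)` and
`f_{θ,k,a}(ρ) = ρ + (√((1−ρ)² − γ(1−ρ)) − θ)²/ρ`. -/
noncomputable def rateI (d : ℕ) (θ k a : ℝ) : ℝ :=
  sInf ((fun ρ : ℝ => ρ + (Real.sqrt ((1 - ρ) ^ 2 - (a + k * d) * (1 - ρ)) - θ) ^ 2 / ρ) ''
    Set.Ioc (0 : ℝ) (1 - (a + k * d) / 2 - Real.sqrt (((a + k * d) / 2) ^ 2 + θ ^ 2)))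

/-- The admissible parameter domain for `I`. -/
def Admissible (d : ℕ) (θ k a : ℝ) : Prop :=
  0 ≤ θ ∧ θ < 1 ∧ 0 ≤ k ∧ k < (1 - θ ^ 2) / d ∧ 0 ≤ a ∧ a < 1 - θ ^ 2 - k * d

/-- The function minimized in `rateI`, in terms of `g = a + k d`. -/
noncomputable def rateF (g θ ρ : ℝ) : ℝ :=
  ρ + (Real.sqrt ((1 - ρ) ^ 2 - g * (1 - ρ)) - θ) ^ 2 / ρ

/-- The right end point of the interval. -/
noncomputable def rhoBar (g θ : ℝ) : ℝ :=
  1 - g / 2 - Real.sqrt ((g / 2) ^ 2 + θ ^ 2)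

lemma rhoBar_pos {g θ : ℝ} (hg : 0 ≤ g) (h : g < 1 - θ ^ 2) : 0 < rhoBar g θ := by
  unfold rhoBar
  have : Real.sqrt ((g / 2) ^ 2 + θ ^ 2) < 1 - g / 2 := by
    rw [Real.sqrt_lt' (by nlinarith [sq_nonneg θ])]
    nlinarith
  linarith

lemma sq_le_of_le_rhoBar {g θ ρ : ℝ} (h : ρ ≤ rhoBar g θ) :
    θ ^ 2 ≤ (1 - ρ) ^ 2 - g * (1 - ρ) := by
  unfold rhoBar at h
  have h0 := Real.sqrt_nonneg ((g / 2) ^ 2 + θ ^ 2)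
  have h1 := Real.sq_sqrt (show 0 ≤ (g / 2) ^ 2 + θ ^ 2 by positivity)
  have h2 : Real.sqrt ((g / 2) ^ 2 + θ ^ 2) ≤ 1 - ρ - g / 2 := by linarith
  have h3 := pow_le_pow_left₀ h0 h2 2
  nlinarith

lemma rateF_rhoBar {g θ : ℝ} (hθ : 0 ≤ θ) : rateF g θ (rhoBar g θ) = rhoBar g θ := by
  have h1 := Real.sq_sqrt (show 0 ≤ (g / 2) ^ 2 + θ ^ 2 by positivity)
  have h2 : (1 - rhoBar g θ) ^ 2 - g * (1 - rhoBar g θ) = θ ^ 2 := by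
    unfold rhoBar
    nlinarith
  unfold rateF
  rw [h2, Real.sqrt_sq hθ]
  simp

lemma rateF_nonneg {g θ ρ : ℝ} (h : 0 < ρ) : ρ ≤ rateF g θ ρ := by
  unfold rateF
  have : 0 ≤ (Real.sqrt ((1 - ρ) ^ 2 - g * (1 - ρ)) - θ) ^ 2 / ρ := by positivity
  linarith

lemma exists_min {g θ : ℝ} (hθ : 0 ≤ θ) (hg : 0 ≤ g) (h : g < 1 - θ ^ 2) :
    ∃ ρ ∈ Set.Ioc 0 (rhoBar g θ), ∀ x ∈ Set.Ioc 0 (rhoBar g θ), rateF g θ ρ ≤ rateF g θ x := by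
  have hp := rhoBar_pos hg h
  set R := rhoBar g θ with hR
  have hc : Continuous fun ρ : ℝ =>
      (Real.sqrt ((1 - ρ) ^ 2 - g * (1 - ρ)) - θ) ^ 2 - R * ρ := by fun_prop
  have h0 : 0 < (Real.sqrt ((1 - (0:ℝ)) ^ 2 - g * (1 - 0)) - θ) ^ 2 - R * 0 := by
    have : θ < Real.sqrt ((1 - (0:ℝ)) ^ 2 - g * (1 - 0)) := by
      rw [Real.lt_sqrt hθ]; linarith
    have h3 : 0 < Real.sqrt ((1 - (0:ℝ)) ^ 2 - g * (1 - 0)) - θ := by linarith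
    rw [mul_zero, sub_zero]
    positivity
  obtain ⟨δ, hδ, hb⟩ := Metric.eventually_nhds_iff.1 (hc.continuousAt.eventually (lt_mem_nhds h0))
  have hδ' : 0 < min (δ / 2) R := lt_min (by linarith) hp
  have hcont : ContinuousOn (rateF g θ) (Set.Icc (min (δ / 2) R) R) := by
    unfold rateF
    apply ContinuousOn.add continuousOn_id
    apply ContinuousOn.div
    · fun_prop
    · fun_prop
    · intro x hx
      exact (lt_of_lt_of_le hδ' hx.1).ne'
  obtain ⟨ρ, hρ, hmin⟩ := isCompact_Icc.exists_isMinOn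
    ⟨R, Set.right_mem_Icc.2 (min_le_right _ _)⟩ hcont
  refine ⟨ρ, ⟨lt_of_lt_of_le hδ' hρ.1, hρ.2⟩, fun x hx => ?_⟩
  by_cases hxm : min (δ / 2) R ≤ x
  · exact hmin ⟨hxm, hx.2⟩
  · have h1 : rateF g θ ρ ≤ rateF g θ R := hmin (Set.right_mem_Icc.2 (min_le_right _ _))
    rw [hR, rateF_rhoBar hθ, ← hR] at h1
    refine h1.trans ?_
    have hxd : x < δ := by
      have := min_le_left (δ / 2) R
      push Not at hxm
      linarith
    have h2 := hb (y := x) (by rw [Real.dist_eq, sub_zero, abs_of_pos hx.1]; exact hxd)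
    have h3 : R ≤ (Real.sqrt ((1 - x) ^ 2 - g * (1 - x)) - θ) ^ 2 / x := by
      rw [le_div_iff₀ hx.1]; linarith
    unfold rateF
    linarith [hx.1]

lemma main_aux {g₁ g₂ θ₁ θ₂ : ℝ} (hθ₁ : 0 ≤ θ₁) (hg₁ : 0 ≤ g₁) (h₁ : g₁ < 1 - θ₁ ^ 2)
    (h₂ : g₂ < 1 - θ₂ ^ 2) (hθ : θ₁ ≤ θ₂) (hg : g₁ ≤ g₂) (hs : θ₁ < θ₂ ∨ g₁ < g₂) :
    sInf (rateF g₂ θ₂ '' Set.Ioc 0 (rhoBar g₂ θ₂)) <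
      sInf (rateF g₁ θ₁ '' Set.Ioc 0 (rhoBar g₁ θ₁)) := by
  obtain ⟨ρ, hρ, hmin⟩ := exists_min hθ₁ hg₁ h₁
  have hp₂ := rhoBar_pos (hg₁.trans hg) h₂
  have hle : rateF g₁ θ₁ ρ ≤ sInf (rateF g₁ θ₁ '' Set.Ioc 0 (rhoBar g₁ θ₁)) := by
    apply le_csInf ⟨_, Set.mem_image_of_mem _ hρ⟩
    rintro _ ⟨x, hx, rfl⟩
    exact hmin x hx
  have hbdd : BddBelow (rateF g₂ θ₂ '' Set.Ioc 0 (rhoBar g₂ θ₂)) := by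
    refine ⟨0, ?_⟩
    rintro _ ⟨x, hx, rfl⟩
    exact hx.1.le.trans (rateF_nonneg hx.1)
  refine lt_of_lt_of_le ?_ hle
  by_cases hc : ρ ≤ rhoBar g₂ θ₂
  · refine lt_of_le_of_lt (csInf_le hbdd (Set.mem_image_of_mem _ ⟨hρ.1, hc⟩)) ?_
    have hu : 0 < 1 - ρ := by
      have hpos : 0 < (g₂ / 2) ^ 2 + θ₂ ^ 2 := by
        rcases hs with hs | hs
        · have : 0 < θ₂ := by linarith
          positivity
        · have : 0 < g₂ := by linarith
          positivity
      have := Real.sqrt_pos.2 hpos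
      unfold rhoBar at hc
      linarith
    have hsq := sq_le_of_le_rhoBar hc
    have hs2 : θ₂ ≤ Real.sqrt ((1 - ρ) ^ 2 - g₂ * (1 - ρ)) := Real.le_sqrt_of_sq_le hsq
    have hlt : Real.sqrt ((1 - ρ) ^ 2 - g₂ * (1 - ρ)) - θ₂ <
        Real.sqrt ((1 - ρ) ^ 2 - g₁ * (1 - ρ)) - θ₁ := by
      rcases hs with hs | hs
      · have := Real.sqrt_le_sqrt (show (1 - ρ) ^ 2 - g₂ * (1 - ρ) ≤ (1 - ρ) ^ 2 - g₁ * (1 - ρ) by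
          nlinarith)
        linarith
      · have := Real.sqrt_lt_sqrt ((sq_nonneg _).trans hsq)
          (show (1 - ρ) ^ 2 - g₂ * (1 - ρ) < (1 - ρ) ^ 2 - g₁ * (1 - ρ) by nlinarith)
        linarith
    have h4 := pow_lt_pow_left₀ hlt (by linarith) two_ne_zero
    have h5 := div_lt_div_of_pos_right h4 hρ.1
    unfold rateF
    linarith
  · push Not at hc
    refine lt_of_le_of_lt (csInf_le hbdd (Set.mem_image_of_mem _ ⟨hp₂, le_rfl⟩)) ?_
    rw [rateF_rhoBar (hθ₁.trans hθ)]
    exact hc.trans_le (rateF_nonneg hρ.1)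

/-- `I` is strictly decreasing in each of its three parameters `θ`, `k`, `a` on the
admissible domain. -/
theorem rateI_strict_anti (d : ℕ) (hd : 1 ≤ d) :
    (∀ θ₁ θ₂ k a : ℝ, Admissible d θ₁ k a → Admissible d θ₂ k a → θ₁ < θ₂ →
      rateI d θ₂ k a < rateI d θ₁ k a) ∧
    (∀ θ k₁ k₂ a : ℝ, Admissible d θ k₁ a → Admissible d θ k₂ a → k₁ < k₂ →
      rateI d θ k₂ a < rateI d θ k₁ a) ∧
    (∀ θ k a₁ a₂ : ℝ, Admissible d θ k a₁ → Admissible d θ k a₂ → a₁ < a₂ →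
      rateI d θ k a₂ < rateI d θ k a₁) := by
  have hd0 : (0 : ℝ) < d := by exact_mod_cast hd
  refine ⟨?_, ?_, ?_⟩
  · rintro θ₁ θ₂ k a ⟨h1, -, h2, -, h3, h4⟩ ⟨-, -, -, -, -, h5⟩ h
    exact main_aux h1 (by positivity) (by linarith) (by linarith) h.le le_rfl (Or.inl h)
  · rintro θ k₁ k₂ a ⟨h1, -, h2, -, h3, h4⟩ ⟨-, -, -, -, -, h5⟩ h
    have hk := mul_lt_mul_of_pos_right h hd0
    exact main_aux h1 (by positivity) (by linarith) (by linarith) le_rfl (by linarith)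
      (Or.inr (by linarith))
  · rintro θ k a₁ a₂ ⟨h1, -, h2, -, h3, h4⟩ ⟨-, -, -, -, -, h5⟩ h
    exact main_aux h1 (by positivity) (by linarith) (by linarith) le_rfl (by linarith)
      (Or.inr (by linarith))
end

section
/- Let d ≥ 1 be an integer, and for admissible parameters (θ,k,a) let ρ̂(θ,k,a) denote the unique minimizer of f_{θ,k,a} on (0, 1−γ), where γ = a + k·d. Then ρ̂ is strictly decreasing in each of its three parameters: (i) if (θ₁,k,a) and (θ₂,k,a) are both admissible and θ₁ < θ₂, then ρ̂(θ₂,k,a) < ρ̂(θ₁,k,a); (ii) if (θ,k₁,a) and (θ,k₂,a) are both admissible and k₁ < k₂, then ρ̂(θ,k₂,a) < ρ̂(θ,k₁,a); (iii) if (θ,k,a₁) and (θ,k,a₂) are both admissible and a₁ < a₂, then ρ̂(θ,k,a₂) < ρ̂(θ,k,a₁). -/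
/-- `ρ` is a minimizer of `f_{θ,k,a}(ρ) = ρ + (√((1−ρ)² − γ(1−ρ)) − θ)²/ρ` on `(0, 1−γ)`,
where `γ = a + k·d`.  (For admissible parameters `f_{θ,k,a}` is strictly convex on this
interval, so such a minimizer is unique; it is denoted `ρ̂(θ,k,a)`.) -/
def IsMinimizer (d : ℕ) (θ k a ρhat : ℝ) : Prop :=
  ρhat ∈ Set.Ioo (0 : ℝ) (1 - (a + k * d)) ∧
  ∀ ρ ∈ Set.Ioo (0 : ℝ) (1 - (a + k * d)),
    ρhat + (Real.sqrt ((1 - ρhat) ^ 2 - (a + k * d) * (1 - ρhat)) - θ) ^ 2 / ρhat ≤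
      ρ + (Real.sqrt ((1 - ρ) ^ 2 - (a + k * d) * (1 - ρ)) - θ) ^ 2 / ρ

/-- Auxiliary function appearing in the first-order condition. -/
noncomputable def hAux (γ ρ : ℝ) : ℝ :=
  (2 * (1 - γ) - (2 - γ) * ρ) / Real.sqrt ((1 - ρ) ^ 2 - γ * (1 - ρ))

lemma rad_pos {γ ρ : ℝ} (hγ : 0 ≤ γ) (h : ρ < 1 - γ) : 0 < (1 - ρ) ^ 2 - γ * (1 - ρ) := by
  have : 0 < (1 - ρ) * (1 - ρ - γ) := mul_pos (by linarith) (by linarith)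
  nlinarith

lemma hasDerivAt_rad (γ ρ : ℝ) :
    HasDerivAt (fun x : ℝ => (1 - x) ^ 2 - γ * (1 - x)) (-(2 * (1 - ρ) - γ)) ρ := by
  have h1 : HasDerivAt (fun x : ℝ => 1 - x) (-1) ρ := by
    simpa using (hasDerivAt_id ρ).const_sub 1
  refine ((h1.pow 2).sub (h1.const_mul γ)).congr_deriv ?_
  push_cast; ring

lemma hasDerivAt_s {γ ρ : ℝ} (hγ : 0 ≤ γ) (h : ρ < 1 - γ) :
    HasDerivAt (fun x : ℝ => Real.sqrt ((1 - x) ^ 2 - γ * (1 - x)))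
      (-(2 * (1 - ρ) - γ) / (2 * Real.sqrt ((1 - ρ) ^ 2 - γ * (1 - ρ)))) ρ :=
  (hasDerivAt_rad γ ρ).sqrt (rad_pos hγ h).ne'

lemma hasDerivAt_hAux {γ ρ : ℝ} (hγ : 0 ≤ γ) (h : ρ < 1 - γ) :
    HasDerivAt (hAux γ)
      (γ ^ 2 * ρ / 2 / Real.sqrt ((1 - ρ) ^ 2 - γ * (1 - ρ)) ^ 3) ρ := by
  have hs := Real.sqrt_pos.2 (rad_pos hγ h)
  have hsq := Real.sq_sqrt (rad_pos hγ h).le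
  have hn : HasDerivAt (fun x : ℝ => 2 * (1 - γ) - (2 - γ) * x) (-(2 - γ)) ρ := by
    simpa using ((hasDerivAt_id ρ).const_mul (2 - γ)).const_sub (2 * (1 - γ))
  have := hn.div (hasDerivAt_s hγ h) hs.ne'
  refine this.congr_deriv ?_
  generalize Real.sqrt ((1 - ρ) ^ 2 - γ * (1 - ρ)) = s at *
  field_simp
  rw [hsq]
  ring

lemma hAux_zero {γ : ℝ} : hAux γ 0 = 2 * Real.sqrt (1 - γ) := by
  unfold hAux
  norm_num
  rw [mul_div_assoc, Real.div_sqrt]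

lemma hAux_mono {γ x y : ℝ} (hγ : 0 ≤ γ) (hx : 0 ≤ x) (hxy : x ≤ y) (hy : y < 1 - γ) :
    hAux γ x ≤ hAux γ y := by
  have : MonotoneOn (hAux γ) (Set.Ico 0 (1 - γ)) := by
    apply monotoneOn_of_deriv_nonneg (convex_Ico _ _)
    · intro z hz
      exact (hasDerivAt_hAux hγ hz.2).continuousAt.continuousWithinAt
    · intro z hz
      rw [interior_Ico] at hz
      exact (hasDerivAt_hAux hγ hz.2).differentiableAt.differentiableWithinAt
    · intro z hz
      rw [interior_Ico] at hz
      rw [(hasDerivAt_hAux hγ hz.2).deriv]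
      have := hz.1
      positivity
  exact this ⟨hx, by linarith⟩ ⟨by linarith, hy⟩ hxy

lemma hAux_diff {γ₁ γ₂ x : ℝ} (h1 : 0 ≤ γ₁) (h12 : γ₁ < γ₂) (hx : 0 ≤ x) (hx2 : x < 1 - γ₂) :
    2 * Real.sqrt (1 - γ₂) - 2 * Real.sqrt (1 - γ₁) ≤ hAux γ₂ x - hAux γ₁ x := by
  have h2 : 0 ≤ γ₂ := by linarith
  have hd : ∀ z, z < 1 - γ₂ → HasDerivAt (fun z => hAux γ₂ z - hAux γ₁ z) _ z := fun z hz =>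
    (hasDerivAt_hAux h2 hz).sub (hasDerivAt_hAux (γ := γ₁) h1 (by linarith))
  have : MonotoneOn (fun z => hAux γ₂ z - hAux γ₁ z) (Set.Ico 0 (1 - γ₂)) := by
    apply monotoneOn_of_deriv_nonneg (convex_Ico _ _)
    · intro z hz
      exact (hd z hz.2).continuousAt.continuousWithinAt
    · intro z hz
      rw [interior_Ico] at hz
      exact (hd z hz.2).differentiableAt.differentiableWithinAt
    · intro z hz
      rw [interior_Ico] at hz
      rw [(hd z hz.2).deriv]
      have hz0 := hz.1
      have hs := Real.sqrt_pos.2 (rad_pos h2 hz.2)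
      rw [sub_nonneg]
      have hq : 0 ≤ 1 - z := by linarith [hz.2]
      gcongr
  have := this ⟨le_refl 0, by linarith⟩ ⟨hx, hx2⟩ hx
  simpa [hAux_zero] using this

lemma foc {γ θ ρ : ℝ} (hγ : 0 ≤ γ) (hρ : ρ ∈ Set.Ioo (0 : ℝ) (1 - γ))
    (hmin : ∀ x ∈ Set.Ioo (0 : ℝ) (1 - γ),
      ρ + (Real.sqrt ((1 - ρ) ^ 2 - γ * (1 - ρ)) - θ) ^ 2 / ρ ≤
      x + (Real.sqrt ((1 - x) ^ 2 - γ * (1 - x)) - θ) ^ 2 / x) :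
    2 * ρ ^ 2 - (1 - γ + θ ^ 2) + θ * hAux γ ρ = 0 := by
  have hloc : IsLocalMin
      (fun x : ℝ => x + (Real.sqrt ((1 - x) ^ 2 - γ * (1 - x)) - θ) ^ 2 / x) ρ := by
    filter_upwards [Ioo_mem_nhds hρ.1 hρ.2] with x hx using hmin x hx
  have hs := Real.sqrt_pos.2 (rad_pos hγ hρ.2)
  have hsq := Real.sq_sqrt (rad_pos hγ hρ.2).le
  have hd := (hasDerivAt_id ρ).add
    ((((hasDerivAt_s hγ hρ.2).sub_const θ).pow 2).div (hasDerivAt_id ρ) hρ.1.ne')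
  have h0 := hloc.hasDerivAt_eq_zero hd
  have hr := hρ.1
  unfold hAux
  simp only [id, Pi.pow_apply] at h0
  generalize Real.sqrt ((1 - ρ) ^ 2 - γ * (1 - ρ)) = s at *
  field_simp at h0 ⊢
  norm_num at h0
  have h3 : s * s^2 = s * ((1 - ρ) ^ 2 - γ * (1 - ρ)) := by rw [hsq]
  have : s * (2 * ρ ^ 2 - (1 - γ + θ ^ 2)) + θ * (2 * (1 - γ) - (2 - γ) * ρ) = 0 := by
    linear_combination h0 / 2 + h3 - 2 * θ * hsq
  linear_combination this

lemma anti_theta {γ θ₁ θ₂ ρ₁ ρ₂ : ℝ} (hγ : 0 ≤ γ) (h0 : 0 ≤ θ₁) (h12 : θ₁ < θ₂)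
    (hθ : θ₂ ^ 2 < 1 - γ)
    (h1 : ρ₁ ∈ Set.Ioo (0 : ℝ) (1 - γ)) (h2 : ρ₂ ∈ Set.Ioo (0 : ℝ) (1 - γ))
    (e1 : 2 * ρ₁ ^ 2 - (1 - γ + θ₁ ^ 2) + θ₁ * hAux γ ρ₁ = 0)
    (e2 : 2 * ρ₂ ^ 2 - (1 - γ + θ₂ ^ 2) + θ₂ * hAux γ ρ₂ = 0) : ρ₂ < ρ₁ := by
  by_contra! hc
  have m := hAux_mono hγ h1.1.le hc h2.2
  have m0 := hAux_mono hγ le_rfl h1.1.le h1.2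
  rw [hAux_zero] at m0
  have hs : θ₂ < Real.sqrt (1 - γ) := Real.lt_sqrt_of_sq_lt hθ
  have a1 : 0 < (θ₂ - θ₁) * (hAux γ ρ₁ - θ₁ - θ₂) := mul_pos (by linarith) (by linarith)
  have a2 : 0 ≤ θ₂ * (hAux γ ρ₂ - hAux γ ρ₁) := mul_nonneg (by linarith) (by linarith)
  have a3 : ρ₁ ^ 2 ≤ ρ₂ ^ 2 := pow_le_pow_left₀ h1.1.le hc 2
  nlinarith

lemma anti_gamma {γ₁ γ₂ θ ρ₁ ρ₂ : ℝ} (hγ : 0 ≤ γ₁) (h0 : 0 ≤ θ) (h12 : γ₁ < γ₂)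
    (hθ : θ ^ 2 < 1 - γ₂)
    (h1 : ρ₁ ∈ Set.Ioo (0 : ℝ) (1 - γ₁)) (h2 : ρ₂ ∈ Set.Ioo (0 : ℝ) (1 - γ₂))
    (e1 : 2 * ρ₁ ^ 2 - (1 - γ₁ + θ ^ 2) + θ * hAux γ₁ ρ₁ = 0)
    (e2 : 2 * ρ₂ ^ 2 - (1 - γ₂ + θ ^ 2) + θ * hAux γ₂ ρ₂ = 0) : ρ₂ < ρ₁ := by
  by_contra! hc
  have m := hAux_mono (by linarith : 0 ≤ γ₂) h1.1.le hc h2.2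
  have m0 := hAux_diff hγ h12 h1.1.le (lt_of_le_of_lt hc h2.2)
  have hs : θ < Real.sqrt (1 - γ₂) := Real.lt_sqrt_of_sq_lt hθ
  have hs' : Real.sqrt (1 - γ₂) < Real.sqrt (1 - γ₁) :=
    Real.sqrt_lt_sqrt (by nlinarith [sq_nonneg θ]) (by linarith)
  have q2 := Real.sq_sqrt (by nlinarith [sq_nonneg θ] : 0 ≤ 1 - γ₂)
  have q1 := Real.sq_sqrt (by nlinarith [sq_nonneg θ] : 0 ≤ 1 - γ₁)
  generalize Real.sqrt (1 - γ₂) = t at *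
  generalize Real.sqrt (1 - γ₁) = u at *
  have a1 : 0 < (u - t) * (u + t - 2 * θ) := mul_pos (by linarith) (by linarith)
  have a2 := mul_le_mul_of_nonneg_left m h0
  have a4 := mul_le_mul_of_nonneg_left m0 h0
  have a3 : ρ₁ ^ 2 ≤ ρ₂ ^ 2 := pow_le_pow_left₀ h1.1.le hc 2
  nlinarith

/-- The minimizer `ρ̂(θ,k,a)` is strictly decreasing in each of the three parameters. -/
theorem rhoHat_strict_anti (d : ℕ) (hd : 1 ≤ d) :
    (∀ θ₁ θ₂ k a ρ₁ ρ₂ : ℝ, Admissible d θ₁ k a → Admissible d θ₂ k a → θ₁ < θ₂ →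
      IsMinimizer d θ₁ k a ρ₁ → IsMinimizer d θ₂ k a ρ₂ → ρ₂ < ρ₁) ∧
    (∀ θ k₁ k₂ a ρ₁ ρ₂ : ℝ, Admissible d θ k₁ a → Admissible d θ k₂ a → k₁ < k₂ →
      IsMinimizer d θ k₁ a ρ₁ → IsMinimizer d θ k₂ a ρ₂ → ρ₂ < ρ₁) ∧
    (∀ θ k a₁ a₂ ρ₁ ρ₂ : ℝ, Admissible d θ k a₁ → Admissible d θ k a₂ → a₁ < a₂ →
      IsMinimizer d θ k a₁ ρ₁ → IsMinimizer d θ k a₂ ρ₂ → ρ₂ < ρ₁) := by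
  have hd' : (0 : ℝ) < d := by exact_mod_cast hd
  have nn : ∀ {θ k a : ℝ}, Admissible d θ k a → 0 ≤ a + k * d := by
    rintro θ k a ⟨-, -, hk, -, ha, -⟩
    positivity
  have lt : ∀ {θ k a : ℝ}, Admissible d θ k a → θ ^ 2 < 1 - (a + k * d) := by
    rintro θ k a ⟨-, -, -, -, -, ha⟩
    linarith
  refine ⟨?_, ?_, ?_⟩
  · intro θ₁ θ₂ k a ρ₁ ρ₂ A1 A2 h m1 m2
    exact anti_theta (nn A1) A1.1 h (lt A2) m1.1 m2.1 (foc (nn A1) m1.1 m1.2)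
      (foc (nn A2) m2.1 m2.2)
  · intro θ k₁ k₂ a ρ₁ ρ₂ A1 A2 h m1 m2
    have := mul_lt_mul_of_pos_right h hd'
    exact anti_gamma (nn A1) A1.1 (by linarith) (lt A2) m1.1 m2.1 (foc (nn A1) m1.1 m1.2)
      (foc (nn A2) m2.1 m2.2)
  · intro θ k a₁ a₂ ρ₁ ρ₂ A1 A2 h m1 m2
    exact anti_gamma (nn A1) A1.1 (by linarith) (lt A2) m1.1 m2.1 (foc (nn A1) m1.1 m1.2)
      (foc (nn A2) m2.1 m2.2)
end

section
/- Let d ≥ 1 be an integer and k ∈ [0, 1/d). Then the map θ ↦ I(θ,k,0) is continuous on the interval [0, √(1−k·d)). -/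
/-- The objective with `g = γ`. -/
noncomputable def auxF (g θ ρ : ℝ) : ℝ :=
  ρ + (Real.sqrt ((1 - ρ) ^ 2 - g * (1 - ρ)) - θ) ^ 2 / ρ

noncomputable def auxR (g θ : ℝ) : ℝ := 1 - g / 2 - Real.sqrt ((g / 2) ^ 2 + θ ^ 2)

lemma auxR_cont (g : ℝ) : Continuous (auxR g) := by
  unfold auxR; fun_prop

lemma auxR_le (g θ : ℝ) (hg : 0 ≤ g) : auxR g θ ≤ 1 := by
  have := Real.sqrt_nonneg ((g / 2) ^ 2 + θ ^ 2)
  unfold auxR; linarith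

lemma auxF_auxR (g θ : ℝ) (hθ : 0 ≤ θ) : auxF g θ (auxR g θ) = auxR g θ := by
  have h : (1 - auxR g θ) ^ 2 - g * (1 - auxR g θ) = θ ^ 2 := by
    have := Real.sq_sqrt (show 0 ≤ (g / 2) ^ 2 + θ ^ 2 by positivity)
    unfold auxR; linear_combination this
  unfold auxF
  rw [h, Real.sqrt_sq hθ]; simp

lemma auxF_nonneg (g θ ρ : ℝ) (h : 0 < ρ) : 0 ≤ auxF g θ ρ := by
  unfold auxF; positivity

lemma auxR_pos (g θ : ℝ) (hg1 : g < 1) (h0 : 0 ≤ θ) (h : θ < Real.sqrt (1 - g)) :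
    0 < auxR g θ := by
  have h2 : θ ^ 2 < 1 - g := (Real.lt_sqrt h0).1 h
  have : Real.sqrt ((g / 2) ^ 2 + θ ^ 2) < 1 - g / 2 := by
    rw [Real.sqrt_lt' (by linarith)]; nlinarith
  unfold auxR; linarith

lemma aux_main (g : ℝ) (hg : 0 ≤ g) (hg1 : g < 1) :
    ContinuousOn (fun θ : ℝ => sInf (auxF g θ '' Set.Ioc 0 (auxR g θ)))
      (Set.Ico 0 (Real.sqrt (1 - g))) := by
  rintro θ₀ ⟨h0, h1⟩
  -- constants
  obtain ⟨m, hm, hm2⟩ : ∃ m, 0 < m ∧ m < Real.sqrt (1 - g) - θ₀ :=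
    exists_between (by linarith)
  have hcont : Continuous (fun p : ℝ × ℝ =>
      Real.sqrt ((1 - p.2) ^ 2 - g * (1 - p.2)) - p.1) := by fun_prop
  have hev : ∀ᶠ p : ℝ × ℝ in nhds (θ₀, 0),
      m < Real.sqrt ((1 - p.2) ^ 2 - g * (1 - p.2)) - p.1 :=
    hcont.continuousAt.eventually (lt_mem_nhds (by simpa using hm2))
  rw [nhds_prod_eq, Filter.eventually_prod_iff] at hev
  obtain ⟨P, hP, Q, hQ, hPQ⟩ := hev
  obtain ⟨δ, hδ, hQδ⟩ := Metric.eventually_nhds_iff.1 hQ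
  have hR0 := auxR_pos g θ₀ hg1 h0 h1
  obtain ⟨c, hc, hcm⟩ : ∃ c, 0 < c ∧ c < min δ (min (m ^ 2) (auxR g θ₀)) :=
    exists_between (by positivity)
  simp only [lt_min_iff] at hcm
  obtain ⟨hcδ, hcm, hcR⟩ := hcm
  have hRev : ∀ᶠ θ in nhds θ₀, c < auxR g θ :=
    (auxR_cont g).continuousAt.eventually (lt_mem_nhds hcR)
  let G : ℝ → ℝ → ℝ := fun θ ρ => auxF g θ (max c (min ρ (auxR g θ)))
  have hG : Continuous (Function.uncurry G) := by
    have hR := auxR_cont g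
    have hq : Continuous (fun p : ℝ × ℝ => max c (min p.2 (auxR g p.1))) := by fun_prop
    have hq0 : ∀ p : ℝ × ℝ, max c (min p.2 (auxR g p.1)) ≠ 0 :=
      fun p => (lt_of_lt_of_le hc (le_max_left _ _)).ne'
    have : Function.uncurry G = fun p : ℝ × ℝ => auxF g p.1 (max c (min p.2 (auxR g p.1))) := by
      ext p; rfl
    rw [this]
    unfold auxF
    refine hq.add (Continuous.div ?_ hq hq0)
    fun_prop
  have hS : Continuous (fun θ => sInf (G θ '' Set.Icc c 1)) :=
    isCompact_Icc.continuous_sInf hG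
  refine (hS.continuousAt.continuousWithinAt (s := Set.Ico 0 (Real.sqrt (1 - g)))).congr_of_eventuallyEq_of_mem ?_ ⟨h0, h1⟩
  filter_upwards [self_mem_nhdsWithin, mem_nhdsWithin_of_mem_nhds hP,
    mem_nhdsWithin_of_mem_nhds hRev] with θ hθ hPθ hRθ
  have hR1 := auxR_le g θ hg
  have himg : G θ '' Set.Icc c 1 = auxF g θ '' Set.Icc c (auxR g θ) := by
    ext y
    constructor
    · rintro ⟨ρ, hρ, rfl⟩
      exact ⟨_, ⟨le_max_left _ _, max_le hRθ.le (min_le_right _ _)⟩, rfl⟩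
    · rintro ⟨ρ, hρ, rfl⟩
      refine ⟨ρ, ⟨hρ.1, hρ.2.trans hR1⟩, ?_⟩
      simp only [G]
      rw [min_eq_left hρ.2, max_eq_right hρ.1]
  change _ = sInf (G θ '' Set.Icc c 1)
  rw [himg]
  have hb1 : BddBelow (auxF g θ '' Set.Ioc 0 (auxR g θ)) := by
    refine ⟨0, ?_⟩
    rintro _ ⟨ρ, hρ, rfl⟩
    exact auxF_nonneg g θ ρ hρ.1
  have hsub : auxF g θ '' Set.Icc c (auxR g θ) ⊆ auxF g θ '' Set.Ioc 0 (auxR g θ) :=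
    Set.image_mono fun ρ hρ => ⟨hc.trans_le hρ.1, hρ.2⟩
  have hb2 := hb1.mono hsub
  have hne : (auxF g θ '' Set.Icc c (auxR g θ)).Nonempty := ⟨_, _, ⟨hRθ.le, le_rfl⟩, rfl⟩
  apply le_antisymm
  · exact csInf_le_csInf hb1 hne hsub
  · refine le_csInf (hne.mono hsub) ?_
    rintro _ ⟨ρ, hρ, rfl⟩
    rcases le_or_gt c ρ with hcρ | hcρ
    · exact csInf_le hb2 ⟨ρ, ⟨hcρ, hρ.2⟩, rfl⟩
    · refine (csInf_le hb2 ⟨auxR g θ, ⟨hRθ.le, le_rfl⟩, rfl⟩).trans ?_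
      rw [auxF_auxR g θ hθ.1]
      refine hR1.trans ?_
      have hQρ : Q ρ := hQδ (by
        rw [Real.dist_eq, sub_zero, abs_of_pos hρ.1]; linarith)
      have hlt := hPQ hPθ hQρ
      simp only at hlt
      unfold auxF
      have : 1 ≤ (Real.sqrt ((1 - ρ) ^ 2 - g * (1 - ρ)) - θ) ^ 2 / ρ := by
        rw [le_div_iff₀ hρ.1]
        nlinarith
      linarith [hρ.1]

/-- For fixed `k ∈ [0, 1/d)`, the map `θ ↦ I(θ,k,0)` is continuous on `[0, √(1−k·d))`. -/
theorem rateI_continuousOn (d : ℕ) (hd : 1 ≤ d) (k : ℝ) (hk0 : 0 ≤ k) (hk1 : k < 1 / d) :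
    ContinuousOn (fun θ : ℝ => rateI d θ k 0) (Set.Ico 0 (Real.sqrt (1 - k * d))) := by
  have hd0 : (0 : ℝ) < d := by exact_mod_cast hd
  have h := aux_main (k * d) (by positivity) ((lt_div_iff₀ hd0).1 hk1)
  refine h.congr fun θ _ => ?_
  simp only [rateI, zero_add]
  rfl
end

section
/- Let d ≥ 1 be an integer, β > 0, θ ∈ [0,1), k ≥ 0, r₀ > 0, and let e be a unit vector in Euclidean space ℝ^d. For t > 0 let B_t denote the Euclidean ball of center θ√(2β)·t·e and radius r₀·e^{−βkt}. Then lim_{t→∞} (1/t)·log( (2πt)^{−d/2} ∫_{B_t} exp(−‖x‖²/(2t)) dx ) = −β(θ² + k·d), where the integral is with respect to Lebesgue measure on ℝ^d. -/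
open MeasureTheory Filter

lemma aux_tendsto (d : ℕ) (K L : ℝ) :
    Tendsto (fun t : ℝ => (1 / t) * (-(d : ℝ) / 2 * Real.log (2 * Real.pi * t) + K + L * t))
      atTop (nhds L) := by
  have h1 : Tendsto (fun t : ℝ => Real.log t / t) atTop (nhds 0) :=
    Real.isLittleO_log_id_atTop.tendsto_div_nhds_zero
  have h2 : Tendsto (fun t : ℝ => t⁻¹) atTop (nhds 0) := tendsto_inv_atTop_zero
  have h3 : Tendsto (fun t : ℝ => -(d : ℝ) / 2 * (Real.log t / t)
      + (-(d : ℝ) / 2 * Real.log (2 * Real.pi) + K) * t⁻¹ + L) atTop (nhds L) := by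
    have := ((h1.const_mul (-(d : ℝ) / 2)).add
      (h2.const_mul (-(d : ℝ) / 2 * Real.log (2 * Real.pi) + K))).add_const L
    simpa using this
  refine h3.congr' ?_
  filter_upwards [eventually_gt_atTop 0] with t ht
  rw [Real.log_mul (by positivity) ht.ne']
  field_simp
  ring

lemma aux_bound {d : ℕ} (a r₀ r t : ℝ) (ha : 0 ≤ a) (hr₀ : 0 < r₀) (hr : r ≤ r₀) (ht : 1 ≤ t)
    (e : EuclideanSpace ℝ (Fin d)) (he : ‖e‖ = 1) (x : EuclideanSpace ℝ (Fin d))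
    (hx : x ∈ Metric.ball ((a * t) • e) r) :
    -(a ^ 2 / 2 * t) - (a * r₀ + r₀ ^ 2) ≤ -‖x‖ ^ 2 / (2 * t) ∧
      -‖x‖ ^ 2 / (2 * t) ≤ -(a ^ 2 / 2 * t) + (a * r₀ + r₀ ^ 2) := by
  have hat : 0 ≤ a * t := by positivity
  have hn : ‖(a * t) • e‖ = a * t := by
    rw [norm_smul, he, mul_one, Real.norm_of_nonneg hat]
  rw [mem_ball_iff_norm] at hx
  have h := (abs_norm_sub_norm_le x ((a * t) • e)).trans (hx.le.trans hr)
  rw [hn] at h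
  obtain ⟨s, hs⟩ : ∃ s, s = ‖x‖ - a * t := ⟨_, rfl⟩
  rw [← hs, abs_le] at h
  have hxs : ‖x‖ = a * t + s := by linarith
  rw [hxs]
  have ht0 : 0 < t := by linarith
  have h1 : a * t * s ≤ a * t * r₀ := mul_le_mul_of_nonneg_left h.2 hat
  have h2 : a * t * (-r₀) ≤ a * t * s := mul_le_mul_of_nonneg_left h.1 hat
  have h3 : s ^ 2 ≤ r₀ ^ 2 := sq_le_sq' h.1 h.2
  have h4 : r₀ ^ 2 ≤ r₀ ^ 2 * t := le_mul_of_one_le_right (by positivity) ht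
  have h5 := sq_nonneg s
  constructor
  · rw [le_div_iff₀ (by positivity)]
    nlinarith
  · rw [div_le_iff₀ (by positivity)]
    nlinarith

/-- Exponential asymptotics for the Gaussian probability of a linearly moving ball with
exponentially shrinking radius:
`lim (1/t)·log( (2πt)^{−d/2} ∫_{B(θ√(2β)t·e, r₀e^{−βkt})} e^{−‖x‖²/(2t)} dx ) = −β(θ² + kd)`. -/
theorem gaussian_prob_moving_shrinking_ball (d : ℕ) (hd : 1 ≤ d) (β θ k r₀ : ℝ)
    (hβ : 0 < β) (hθ0 : 0 ≤ θ) (hθ1 : θ < 1) (hk : 0 ≤ k) (hr₀ : 0 < r₀)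
    (e : EuclideanSpace ℝ (Fin d)) (he : ‖e‖ = 1) :
    Tendsto (fun t : ℝ =>
        (1 / t) * Real.log ((2 * Real.pi * t) ^ (-(d : ℝ) / 2) *
          ∫ x in Metric.ball ((θ * Real.sqrt (2 * β) * t) • e) (r₀ * Real.exp (-(β * k * t))),
            Real.exp (-‖x‖ ^ 2 / (2 * t))))
      atTop (nhds (-(β * (θ ^ 2 + k * d)))) := by
  obtain ⟨a, ha⟩ : ∃ a, a = θ * Real.sqrt (2 * β) := ⟨_, rfl⟩
  have ha0 : 0 ≤ a := by rw [ha]; positivity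
  have ha2 : a ^ 2 / 2 = β * θ ^ 2 := by
    rw [ha, mul_pow, Real.sq_sqrt (by positivity)]; ring
  rw [← ha]
  obtain ⟨C, hC⟩ : ∃ C, C = a * r₀ + r₀ ^ 2 := ⟨_, rfl⟩
  obtain ⟨c, hc⟩ : ∃ c, c = volume.real (Metric.ball (0 : EuclideanSpace ℝ (Fin d)) 1) := ⟨_, rfl⟩
  have hc0 : 0 < c := by
    rw [hc]
    exact ENNReal.toReal_pos (Metric.measure_ball_pos _ _ one_pos).ne' measure_ball_lt_top.ne
  have key : ∀ t : ℝ, 1 ≤ t → ∀ J : ℝ,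
      J = Real.log ((2 * Real.pi * t) ^ (-(d : ℝ) / 2) *
          ∫ x in Metric.ball ((a * t) • e) (r₀ * Real.exp (-(β * k * t))),
            Real.exp (-‖x‖ ^ 2 / (2 * t))) →
      -(d : ℝ) / 2 * Real.log (2 * Real.pi * t) + (d * Real.log r₀ + Real.log c - C)
        + (-(β * (θ ^ 2 + k * d))) * t ≤ J ∧
      J ≤ -(d : ℝ) / 2 * Real.log (2 * Real.pi * t) + (d * Real.log r₀ + Real.log c + C)
        + (-(β * (θ ^ 2 + k * d))) * t := by
    intro t ht J hJ
    have ht0 : 0 < t := by linarith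
    obtain ⟨r, hr⟩ : ∃ r, r = r₀ * Real.exp (-(β * k * t)) := ⟨_, rfl⟩
    have hr0 : 0 < r := by rw [hr]; positivity
    have hrr : r ≤ r₀ := by
      rw [hr]
      apply mul_le_of_le_one_right hr₀.le
      rw [Real.exp_le_one_iff]
      have : 0 ≤ β * k * t := by positivity
      linarith
    have hlr : Real.log r = Real.log r₀ - β * k * t := by
      rw [hr, Real.log_mul hr₀.ne' (Real.exp_pos _).ne', Real.log_exp]; ring
    rw [← hr] at hJ
    have hb := fun x hx => aux_bound a r₀ r t ha0 hr₀ hrr ht e he x hx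
    rw [← hC] at hb
    have hV : volume.real (Metric.ball ((a * t) • e) r) = r ^ d * c := by
      rw [measureReal_def, Measure.addHaar_ball_of_pos _ _ hr0, ENNReal.toReal_mul,
        ENNReal.toReal_ofReal (by positivity), hc, measureReal_def]
      simp
    have hfin : volume (Metric.ball ((a * t) • e) r) ≠ ⊤ := measure_ball_lt_top.ne
    have hint : IntegrableOn (fun x : EuclideanSpace ℝ (Fin d) => Real.exp (-‖x‖ ^ 2 / (2 * t)))
        (Metric.ball ((a * t) • e) r) := by
      have hcont : Continuous
          (fun x : EuclideanSpace ℝ (Fin d) => Real.exp (-‖x‖ ^ 2 / (2 * t))) := by fun_prop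
      exact (hcont.continuousOn.integrableOn_compact
        (isCompact_closedBall ((a * t) • e) r)).mono_set Metric.ball_subset_closedBall
    have hconst : ∀ y : ℝ, ∫ x in Metric.ball ((a * t) • e) r, y = r ^ d * c * y := by
      intro y
      rw [setIntegral_const, hV, smul_eq_mul]
    have hlo : r ^ d * c * Real.exp (-(a ^ 2 / 2 * t) - C) ≤
        ∫ x in Metric.ball ((a * t) • e) r, Real.exp (-‖x‖ ^ 2 / (2 * t)) := by
      rw [← hconst]
      exact setIntegral_mono_on (integrableOn_const hfin) hint measurableSet_ball
        (fun x hx => Real.exp_le_exp.2 (hb x hx).1)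
    have hhi : ∫ x in Metric.ball ((a * t) • e) r, Real.exp (-‖x‖ ^ 2 / (2 * t)) ≤
        r ^ d * c * Real.exp (-(a ^ 2 / 2 * t) + C) := by
      rw [← hconst]
      exact setIntegral_mono_on hint (integrableOn_const hfin) measurableSet_ball
        (fun x hx => Real.exp_le_exp.2 (hb x hx).2)
    generalize (∫ x in Metric.ball ((a * t) • e) r, Real.exp (-‖x‖ ^ 2 / (2 * t))) = I at *
    have hlog : ∀ y : ℝ, Real.log (r ^ d * c * Real.exp y)
        = d * (Real.log r₀ - β * k * t) + Real.log c + y := by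
      intro y
      rw [Real.log_mul (by positivity) (Real.exp_pos _).ne', Real.log_exp,
        Real.log_mul (by positivity) hc0.ne', Real.log_pow, hlr]
    have hlow0 : 0 < r ^ d * c * Real.exp (-(a ^ 2 / 2 * t) - C) := by positivity
    have hI : 0 < I := hlow0.trans_le hlo
    have hpt : 0 < 2 * Real.pi * t := by positivity
    have l1 := Real.log_le_log hlow0 hlo
    have l2 := Real.log_le_log hI hhi
    rw [hlog, ha2] at l1 l2
    rw [hJ, Real.log_mul (Real.rpow_pos_of_pos hpt _).ne' hI.ne', Real.log_rpow hpt]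
    constructor <;> linarith
  refine tendsto_of_tendsto_of_tendsto_of_le_of_le'
    (aux_tendsto d (d * Real.log r₀ + Real.log c - C) (-(β * (θ ^ 2 + k * d))))
    (aux_tendsto d (d * Real.log r₀ + Real.log c + C) (-(β * (θ ^ 2 + k * d)))) ?_ ?_
  · filter_upwards [eventually_ge_atTop 1] with t ht
    exact mul_le_mul_of_nonneg_left (key t ht _ rfl).1 (by positivity)
  · filter_upwards [eventually_ge_atTop 1] with t ht
    exact mul_le_mul_of_nonneg_left (key t ht _ rfl).2 (by positivity)
end

section
/- Let γ > 0. For t > 0 let μ_t be the Gaussian measure on ℝ with mean 0 and variance t. Then lim_{t→∞} (1/t)·log( μ_t({x ∈ ℝ : |x| > γt}) ) = −γ²/2. -/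
open MeasureTheory Filter ProbabilityTheory

lemma aux_upper (γ t : ℝ) (hγ : 0 < γ) (ht : 0 < t) :
    (gaussianReal 0 (Real.toNNReal t) {x : ℝ | γ * t < |x|}).toReal
      ≤ 2 * Real.exp (-γ ^ 2 / 2 * t) := by
  have h : HasSubgaussianMGF (fun x : ℝ => x) t.toNNReal (gaussianReal 0 t.toNNReal) := by
    refine ⟨fun s => integrable_exp_mul_gaussianReal s, fun s => ?_⟩
    rw [mgf_fun_id_gaussianReal]
    simp
  have h2 : HasSubgaussianMGF (fun x : ℝ => -x) t.toNNReal (gaussianReal 0 t.toNNReal) := h.neg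
  have hp : 0 ≤ γ * t := by positivity
  have e : Real.exp (-(γ * t) ^ 2 / (2 * (t.toNNReal : ℝ))) = Real.exp (-γ ^ 2 / 2 * t) := by
    rw [Real.coe_toNNReal t ht.le]
    congr 1
    field_simp
  have a1 := h.measure_ge_le hp
  have a2 := h2.measure_ge_le hp
  rw [e] at a1 a2
  change (gaussianReal 0 (Real.toNNReal t)).real {x : ℝ | γ * t < |x|} ≤ _
  calc _ ≤ (gaussianReal 0 (Real.toNNReal t)).real
            ({x : ℝ | γ * t ≤ x} ∪ {x : ℝ | γ * t ≤ -x}) := by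
        apply measureReal_mono
        · intro x hx
          simp only [Set.mem_ofPred_eq, Set.mem_union] at hx ⊢
          rcases lt_abs.1 hx with h | h
          · exact Or.inl h.le
          · exact Or.inr h.le
        · exact measure_ne_top _ _
    _ ≤ _ := measureReal_union_le _ _
    _ ≤ _ := by linarith

lemma aux_lower (γ t : ℝ) (hγ : 0 < γ) (ht : 0 < t) :
    (Real.sqrt (2 * Real.pi * t))⁻¹ * Real.exp (-(γ * t + 1) ^ 2 / (2 * t)) ≤
    (gaussianReal 0 (Real.toNNReal t) {x : ℝ | γ * t < |x|}).toReal := by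
  have hv : t.toNNReal ≠ 0 := by simpa using ht
  have hp : 0 ≤ γ * t := by positivity
  set c := (Real.sqrt (2 * Real.pi * t))⁻¹ * Real.exp (-(γ * t + 1) ^ 2 / (2 * t)) with hc
  have hc0 : 0 ≤ c := by positivity
  rw [← ENNReal.ofReal_le_iff_le_toReal (measure_ne_top _ _)]
  rw [gaussianReal_apply _ hv]
  calc ENNReal.ofReal c = ∫⁻ x in Set.Ioc (γ * t) (γ * t + 1), ENNReal.ofReal c := by simp
    _ ≤ ∫⁻ x in Set.Ioc (γ * t) (γ * t + 1), gaussianPDF 0 t.toNNReal x := by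
        apply setLIntegral_mono (measurable_gaussianPDF _ _)
        intro x hx
        rw [gaussianPDF_def]
        apply ENNReal.ofReal_le_ofReal
        rw [gaussianPDFReal_def, hc, Real.coe_toNNReal t ht.le]
        beta_reduce
        rw [sub_zero]
        have : x ^ 2 ≤ (γ * t + 1) ^ 2 := by
          have := hx.1
          have := hx.2
          gcongr
          linarith
        gcongr
    _ ≤ _ := by
        apply lintegral_mono_set
        intro x hx
        exact lt_of_lt_of_le hx.1 (le_abs_self x)

/-- One-dimensional endpoint large-deviation estimate: if `μ_t` is the centered Gaussian
measure on `ℝ` with variance `t`, then `lim (1/t)·log μ_t{|x| > γt} = −γ²/2`. -/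
theorem gaussianReal_tail_linear (γ : ℝ) (hγ : 0 < γ) :
    Tendsto (fun t : ℝ =>
        (1 / t) * Real.log
          ((gaussianReal 0 (Real.toNNReal t) {x : ℝ | γ * t < |x|}).toReal))
      atTop (nhds (-γ ^ 2 / 2)) := by
  have hinv : Tendsto (fun t : ℝ => t⁻¹) atTop (nhds 0) := tendsto_inv_atTop_zero
  have hlog : Tendsto (fun t : ℝ => Real.log t / t) atTop (nhds 0) :=
    Real.isLittleO_log_id_atTop.tendsto_div_nhds_zero
  have hU : Tendsto (fun t : ℝ => Real.log 2 * t⁻¹ + -γ ^ 2 / 2) atTop (nhds (-γ ^ 2 / 2)) := by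
    simpa using (hinv.const_mul (Real.log 2)).add_const (-γ ^ 2 / 2)
  have hL : Tendsto (fun t : ℝ => -(Real.log (2 * Real.pi) * t⁻¹ + Real.log t / t) / 2
      + -(γ + t⁻¹) ^ 2 / 2) atTop (nhds (-γ ^ 2 / 2)) := by
    have := ((((hinv.const_mul (Real.log (2 * Real.pi))).add hlog).neg.div_const 2).add
      (((hinv.const_add γ).pow 2).neg.div_const 2))
    simpa using this
  refine tendsto_of_tendsto_of_tendsto_of_le_of_le' hL hU ?_ ?_
  · filter_upwards [eventually_gt_atTop 0] with t ht
    have h := Real.log_le_log (by positivity) (aux_lower γ t hγ ht)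
    rw [Real.log_mul (by positivity) (by positivity), Real.log_exp, Real.log_inv,
      Real.log_sqrt (by positivity), Real.log_mul (by positivity) ht.ne'] at h
    calc _ = (1 / t) * (-((Real.log (2 * Real.pi) + Real.log t) / 2)
              + -(γ * t + 1) ^ 2 / (2 * t)) := by
          field_simp
      _ ≤ _ := by gcongr
  · filter_upwards [eventually_gt_atTop 0] with t ht
    have h := Real.log_le_log (lt_of_lt_of_le (by positivity) (aux_lower γ t hγ ht))
      (aux_upper γ t hγ ht)
    rw [Real.log_mul (by positivity) (by positivity), Real.log_exp] at h
    calc _ ≤ (1 / t) * (Real.log 2 + -γ ^ 2 / 2 * t) := by gcongr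
      _ = _ := by
          field_simp
end
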